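/- (Lemma 2, correctness of the utility-occupancy upper bound) Let W be an ≺-extension of an itemset X in a database D, and let m be a positive integer with m ≤ sup(W). Then uo(W) ≤ φ̂ := Top_m(T ↦ uo(X,T) + ruo(X,T), Γ_X) / m; that is, the average of the m largest values of uo(X,T) + ruo(X,T) over the supporting transactions of X is an upper bound on the utility occupancy of every ≺-extension of X supported by at least m transactions. -/

import Mathlib

open Finset

/-- Transaction utility: total utility of all items in transaction `T`. -/
noncomputable def tu {ι τ : Type*} (items : τ → Finset ι) (u : ι → τ → ℝ) (T : τ) : ℝ :=
  ∑ i ∈ items T, u i T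

/-- Utility occupancy of an itemset `X` in a transaction `T`. -/
noncomputable def uo {ι τ : Type*} (items : τ → Finset ι) (u : ι → τ → ℝ)
    (X : Finset ι) (T : τ) : ℝ :=
  (∑ i ∈ X, u i T) / tu items u T

/-- Remaining utility occupancy of an itemset `X` in a transaction `T`. -/
noncomputable def ruo {ι τ : Type*} [LinearOrder ι] (items : τ → Finset ι) (u : ι → τ → ℝ)
    (X : Finset ι) (T : τ) : ℝ :=
  (∑ i ∈ (items T).filter (fun j => ∀ x ∈ X, x < j), u i T) / tu items u T

/-- Supporting transactions of itemset `X` in database `D`. -/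
def supTrans {ι τ : Type*} [DecidableEq ι] (items : τ → Finset ι) (D : Finset τ)
    (X : Finset ι) : Finset τ :=
  D.filter (fun T => X ⊆ items T)

/-- Utility occupancy of an itemset `X` in a database `D`. -/
noncomputable def uoDB {ι τ : Type*} [DecidableEq ι] (items : τ → Finset ι) (u : ι → τ → ℝ)
    (D : Finset τ) (X : Finset ι) : ℝ :=
  (∑ T ∈ supTrans items D X, uo items u X T) / (supTrans items D X).card

/-- `W` is an `≺`-extension of `X`. -/
def IsExtension {ι : Type*} [LinearOrder ι] (X W : Finset ι) : Prop :=
  X ⊆ W ∧ ∀ x ∈ X, ∀ w ∈ W \ X, x < w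

/-- `topSum k v S`: the maximum of `Σ_{s ∈ A} v s` over all `k`-element subsets
`A ⊆ S` (the sum of the `k` largest values of `v` on `S`). -/
noncomputable def topSum {α : Type*} (k : ℕ) (v : α → ℝ) (S : Finset α) : ℝ :=
  sSup ((fun A : Finset α => ∑ s ∈ A, v s) '' {A : Finset α | A ⊆ S ∧ A.card = k})

/-- Some `m`-element subset of `S` has average value at least the average over `S`. -/
lemma exists_subset_card_eq_average_le {α : Type*} (v : α → ℝ) (m : ℕ) (S : Finset α)
    (hm : m ≤ S.card) :
    ∃ A ⊆ S, A.card = m ∧ (m : ℝ) * ∑ s ∈ S, v s ≤ S.card * ∑ s ∈ A, v s := by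
  classical
  induction S using Finset.strongInduction with
  | H S ih =>
    rcases hm.eq_or_lt with h | h
    · exact ⟨S, Subset.rfl, h.symm, by rw [h]⟩
    · obtain ⟨a, ha, hmin⟩ := S.exists_min_image v (card_pos.1 (by omega))
      have hcard := card_erase_add_one ha
      obtain ⟨A, hAS, hA, hle⟩ := ih (S.erase a) (erase_ssubset ha) (by omega)
      have hAS' : A ⊆ S := hAS.trans (erase_subset a S)
      refine ⟨A, hAS', hA, ?_⟩
      have hlow : (m : ℝ) * v a ≤ ∑ s ∈ A, v s := by
        have := A.card_nsmul_le_sum v (v a) fun s hs => hmin s (hAS' hs)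
        rwa [hA, nsmul_eq_mul] at this
      rw [← hcard, ← add_sum_erase S v ha]
      push_cast
      linarith

lemma sum_le_topSum {α : Type*} (v : α → ℝ) {A S : Finset α} (hAS : A ⊆ S) :
    ∑ s ∈ A, v s ≤ topSum A.card v S := by
  refine le_csSup (Set.Finite.bddAbove (Set.Finite.image _ ?_)) ⟨A, ⟨hAS, rfl⟩, rfl⟩
  exact S.powerset.finite_toSet.subset fun B hB => mem_coe.2 (mem_powerset.2 hB.1)

/-- The average over `S` is at most the average of the `m` largest values on any superset. -/
lemma sum_div_card_le_topSum_div {α : Type*} (v : α → ℝ) {m : ℕ} {S S' : Finset α}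
    (hSS' : S ⊆ S') (hm1 : 1 ≤ m) (hm2 : m ≤ S.card) :
    (∑ s ∈ S, v s) / S.card ≤ topSum m v S' / m := by
  obtain ⟨A, hAS, rfl, hle⟩ := exists_subset_card_eq_average_le v m S hm2
  have hApos : (0 : ℝ) < A.card := by exact_mod_cast hm1
  have hSpos : (0 : ℝ) < S.card := by exact_mod_cast hm1.trans hm2
  rw [div_le_div_iff₀ hSpos hApos, mul_comm, mul_comm (topSum _ _ _)]
  exact hle.trans (mul_le_mul_of_nonneg_left (sum_le_topSum v (hAS.trans hSS')) hSpos.le)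

lemma supTrans_anti {ι τ : Type*} [DecidableEq ι] (items : τ → Finset ι) (D : Finset τ)
    {X W : Finset ι} (h : X ⊆ W) : supTrans items D W ⊆ supTrans items D X :=
  monotone_filter_right D fun _ _ hT => h.trans hT

/-- In a transaction supporting an extension `W` of `X`, the occupancy of `W` is bounded by the
occupancy of `X` plus its remaining occupancy. -/
lemma uo_le_uo_add_ruo {ι τ : Type*} [LinearOrder ι] (items : τ → Finset ι) (u : ι → τ → ℝ)
    {X W : Finset ι} (hext : IsExtension X W) {T : τ} (hu : ∀ i ∈ items T, 0 ≤ u i T)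
    (hW : W ⊆ items T) : uo items u W T ≤ uo items u X T + ruo items u X T := by
  unfold uo ruo
  rw [← add_div, ← sum_sdiff hext.1, add_comm]
  refine div_le_div_of_nonneg_right (add_le_add_right ?_ _) (sum_nonneg hu)
  refine sum_le_sum_of_subset_of_nonneg (fun w hw => ?_)
    fun i hi _ => hu i (mem_filter.1 hi).1
  exact mem_filter.2 ⟨hW (mem_sdiff.1 hw).1, fun x hx => hext.2 x hx w hw⟩

/-- Lemma 2: correctness of the utility-occupancy upper bound. -/
theorem lemma2_upper_bound {ι τ : Type*} [LinearOrder ι]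
    (items : τ → Finset ι) (u : ι → τ → ℝ) (D : Finset τ)
    (hu : ∀ T ∈ D, ∀ i ∈ items T, 0 ≤ u i T) (htu : ∀ T ∈ D, 0 < tu items u T)
    (X W : Finset ι) (hext : IsExtension X W)
    (m : ℕ) (hm1 : 1 ≤ m) (hm2 : m ≤ (supTrans items D W).card) :
    uoDB items u D W ≤
      topSum m (fun T => uo items u X T + ruo items u X T) (supTrans items D X) / m := by
  refine le_trans ?_ (sum_div_card_le_topSum_div _ (supTrans_anti items D hext.1) hm1 hm2)
  refine div_le_div_of_nonneg_right (sum_le_sum fun T hT => ?_) (Nat.cast_nonneg _)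
  obtain ⟨hTD, hTW⟩ := mem_filter.1 hT
  exact uo_le_uo_add_ruo items u hext (hu T hTD) hTW
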